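/- arXiv:2401.02765 — 4 statements merged into one kernel-verified Lean document; each statement's English description precedes it below -/
import Mathlib

section
/- If G is any finite simple graph of order n ≥ 1, then either γ(G) ≤ ⌊√n⌋ or γ(Ḡ) ≤ ⌊√n⌋, where Ḡ denotes the complement of G. -/
/-- `D` is a dominating set of `G`: every vertex outside `D` has a neighbor in `D`. -/
def SimpleGraph.IsDomSet {V : Type*} (G : SimpleGraph V) (D : Set V) : Prop :=
  ∀ v ∉ D, ∃ u ∈ D, G.Adj u v

/-- The domination number of `G`. -/
noncomputable def SimpleGraph.domNum {V : Type*} [Fintype V] (G : SimpleGraph V) : ℕ :=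
  sInf {m | ∃ D : Set V, G.IsDomSet D ∧ D.ncard = m}

namespace SimpleGraph

variable {V : Type*} (G : SimpleGraph V)

/-- `x` is adjacent to all other vertices in its fiber under `f`. -/
def IsFiberCenter {ι : Type*} (f : V → ι) (x : V) : Prop :=
  ∀ v, f v = f x → v ≠ x → G.Adj x v

variable {G}

lemma IsDomSet.domNum_le [Fintype V] {D : Set V} (hD : G.IsDomSet D) :
    G.domNum ≤ D.ncard :=
  Nat.sInf_le ⟨D, hD, rfl⟩

variable (G) in
lemma exists_isDomSet_ncard_eq_domNum [Fintype V] :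
    ∃ D : Set V, G.IsDomSet D ∧ D.ncard = G.domNum :=
  Nat.sInf_mem (s := {m | ∃ D : Set V, G.IsDomSet D ∧ D.ncard = m})
    ⟨_, Set.univ, fun v hv => absurd (Set.mem_univ v) hv, rfl⟩

/-- A dominating set splits the vertices into stars centered at its elements. -/
lemma IsDomSet.exists_fiberCenters {D : Set V} (hD : G.IsDomSet D) :
    ∃ f : V → D, ∀ i, ∃ x, f x = i ∧ G.IsFiberCenter f x := by
  have h : ∀ v, ∃ i : D, (v ∈ D → (i : V) = v) ∧ (v ∉ D → G.Adj i v) := by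
    intro v
    by_cases hv : v ∈ D
    · exact ⟨⟨v, hv⟩, fun _ => rfl, fun h => absurd hv h⟩
    · obtain ⟨u, hu, huv⟩ := hD v hv
      exact ⟨⟨u, hu⟩, fun h => absurd h hv, fun _ => huv⟩
  choose f hfD hf using h
  have hfi (i : D) : f i = i := Subtype.ext (hfD i i.2)
  refine ⟨f, fun i => ⟨i, hfi i, fun v hv hne => ?_⟩⟩
  rw [hfi] at hv
  subst hv
  exact hf v fun hvD => hne (hfD v hvD).symm

/-- If a fiber center is adjacent to all of another fiber, one can dominate `G` with fewer
vertices than there are fibers. -/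
lemma domNum_lt_card_of_isFiberCenter [Fintype V] {ι : Type*} [Fintype ι] {f : V → ι}
    (hf : ∀ i, ∃ x, f x = i ∧ G.IsFiberCenter f x) {v : V} {i : ι} (hvi : f v ≠ i)
    (hadj : ∀ u, f u = i → G.Adj u v) (hv : G.IsFiberCenter f v) :
    G.domNum < Fintype.card ι := by
  classical
  choose c hfc hc using hf
  have hD : G.IsDomSet (Function.update c (f v) v '' {i}ᶜ) := by
    intro w hw
    have hmem : v ∈ Function.update c (f v) v '' {i}ᶜ := ⟨f v, hvi, by simp⟩
    have hwv : w ≠ v := by rintro rfl; exact hw hmem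
    by_cases hwi : f w = i
    · exact ⟨v, hmem, (hadj w hwi).symm⟩
    by_cases hwf : f w = f v
    · exact ⟨v, hmem, hv w hwf hwv⟩
    · have hcw : c (f w) ∈ Function.update c (f v) v '' {i}ᶜ :=
        ⟨f w, hwi, Function.update_of_ne hwf _ _⟩
      exact ⟨_, hcw, hc (f w) w (hfc _).symm fun h => hw (h ▸ hcw)⟩
  calc G.domNum ≤ _ := hD.domNum_le
    _ ≤ ({i}ᶜ : Set ι).ncard := Set.ncard_image_le
    _ < (Set.univ : Set ι).ncard := Set.ncard_lt_ncard
        ⟨Set.subset_univ _, fun h => h (Set.mem_univ i) rfl⟩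
    _ = Fintype.card ι := by rw [Set.ncard_univ, Nat.card_eq_fintype_card]

/-- Moving `v` to a fiber all of whose vertices are adjacent to `v` keeps all other
fiber centers and makes `v` one. -/
lemma isFiberCenter_update [DecidableEq V] {ι : Type*} {f : V → ι} {v : V} {i : ι}
    (hadj : ∀ u, f u = i → G.Adj u v) {x : V} (hx : x = v ∨ G.IsFiberCenter f x) :
    G.IsFiberCenter (Function.update f v i) x := by
  intro w hw hwx
  by_cases hxv : x = v
  · subst hxv
    rw [Function.update_self, Function.update_of_ne hwx] at hw
    exact (hadj w hw).symm
  have hx := hx.resolve_left hxv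
  rw [Function.update_of_ne hxv] at hw
  by_cases hwv : w = v
  · subst hwv
    rw [Function.update_self] at hw
    exact hadj x hw.symm
  · rw [Function.update_of_ne hwv] at hw
    exact hx w hw hwx

variable (G) in
/-- The Jaeger–Payan inequality `γ(G) γ(Ḡ) ≤ n`. -/
theorem domNum_mul_domNum_compl_le [Fintype V] :
    G.domNum * Gᶜ.domNum ≤ Fintype.card V := by
  classical
  obtain ⟨D, hD, hcard⟩ := G.exists_isDomSet_ncard_eq_domNum
  rw [← Nat.card_coe_set_eq, Nat.card_eq_fintype_card] at hcard
  obtain ⟨f, hf, hmax⟩ := Set.exists_max_image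
    {f : V → D | ∀ i, ∃ x, f x = i ∧ G.IsFiberCenter f x}
    (fun f => {x | G.IsFiberCenter f x}.ncard) (Set.toFinite _) hD.exists_fiberCenters
  have hdom (i : D) : Gᶜ.IsDomSet {v | f v = i} := by
    intro v hvi
    by_contra! hno
    have hadj : ∀ u, f u = i → G.Adj u v := by
      intro u hu
      by_contra huv
      exact hno u hu ((G.compl_adj u v).2 ⟨by rintro rfl; exact hvi hu, huv⟩)
    have hv : ¬ G.IsFiberCenter f v := fun hv =>
      (domNum_lt_card_of_isFiberCenter hf hvi hadj hv).ne' hcard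
    refine (hmax (Function.update f v i) fun j => ?_).not_gt (Set.ncard_lt_ncard ?_)
    · obtain ⟨x, hxj, hx⟩ := hf j
      have hxv : x ≠ v := by rintro rfl; exact hv hx
      exact ⟨x, by rwa [Function.update_of_ne hxv], isFiberCenter_update hadj (.inr hx)⟩
    · exact ⟨fun x hx => isFiberCenter_update hadj (.inr hx),
        fun h => hv (h (isFiberCenter_update hadj (.inl rfl)))⟩
  calc G.domNum * Gᶜ.domNum = ∑ _i : D, Gᶜ.domNum := by simp [← hcard]
    _ ≤ ∑ i : D, (Finset.univ.filter (f · = i)).card := by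
        refine Finset.sum_le_sum fun i _ => (hdom i).domNum_le.trans_eq ?_
        rw [← Set.ncard_coe_finset]
        simp
    _ = Fintype.card V :=
        (Finset.card_eq_sum_card_fiberwise fun _ _ => Finset.mem_coe.2 (Finset.mem_univ _)).symm

end SimpleGraph

/-- For any graph `G` of order `n ≥ 1`, either `γ(G) ≤ ⌊√n⌋` or `γ(Ḡ) ≤ ⌊√n⌋`. -/
theorem domNum_le_sqrt_or_compl {V : Type*} [Fintype V] (G : SimpleGraph V)
    (hn : 1 ≤ Fintype.card V) :
    G.domNum ≤ ⌊Real.sqrt (Fintype.card V)⌋₊ ∨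
      Gᶜ.domNum ≤ ⌊Real.sqrt (Fintype.card V)⌋₊ := by
  rw [Real.nat_floor_real_sqrt_eq_nat_sqrt]
  by_contra! h
  have := Nat.mul_le_mul (Nat.succ_le_of_lt h.1) (Nat.succ_le_of_lt h.2)
  exact (Nat.lt_succ_sqrt (Fintype.card V)).not_ge
    (this.trans G.domNum_mul_domNum_compl_le)
end

section
/- Let G be a finite simple graph of order n ≥ 2 that is not in SCC(2), i.e., it is not the case that G and its complement Ḡ are both connected with rad(G) = diam(G) = rad(Ḡ) = diam(Ḡ) = 2. Then γ(G) ≤ 2 or γ(Ḡ) ≤ 2. -/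
/-- The radius of `G`: the minimum over vertices `v` of the maximum distance
from `v` to any other vertex. -/
noncomputable def SimpleGraph.rad {V : Type*} (G : SimpleGraph V) : ℕ :=
  (⨅ v : V, ⨆ w : V, G.edist v w).toNat

/-- `G` is a `2`-complementary self-centered graph: both `G` and `Ḡ` are connected and
`rad(G) = diam(G) = rad(Ḡ) = diam(Ḡ) = 2`. -/
def SimpleGraph.IsSCC2 {V : Type*} (G : SimpleGraph V) : Prop :=
  G.Connected ∧ Gᶜ.Connected ∧ G.rad = 2 ∧ G.diam = 2 ∧ Gᶜ.rad = 2 ∧ Gᶜ.diam = 2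

/-- If the domination number exceeds `2`, any two vertices have a common neighbor in the
complement. -/
theorem SimpleGraph.exists_compl_adj_of_two_lt_domNum {V : Type*} [Fintype V] {G : SimpleGraph V}
    (h : 2 < G.domNum) (u v : V) : ∃ w, Gᶜ.Adj u w ∧ Gᶜ.Adj w v := by
  by_contra! hc
  refine h.not_ge ?_
  have hD : G.IsDomSet {u, v} := by
    intro w hw
    simp only [Set.mem_insert_iff, Set.mem_singleton_iff, not_or] at hw
    by_contra! hn
    exact hc w ((G.compl_adj u w).2 ⟨Ne.symm hw.1, hn u (by simp)⟩)
      ((G.compl_adj w v).2 ⟨hw.2, fun h' ↦ hn v (by simp) h'.symm⟩)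
  have hle : G.domNum ≤ ({u, v} : Set V).ncard := Nat.sInf_le ⟨_, hD, rfl⟩
  exact hle.trans ((Set.ncard_insert_le u {v}).trans (by simp))

/-- If any two vertices have a common neighbor and no vertex is universal, then the graph is
connected with radius and diameter `2`. -/
theorem SimpleGraph.connected_rad_diam_of_exists_adj {V : Type*} [Nonempty V] {G : SimpleGraph V}
    (h : ∀ u v, ∃ w, G.Adj u w ∧ G.Adj w v) (hc : ∀ u, ∃ w, Gᶜ.Adj u w) :
    G.Connected ∧ G.rad = 2 ∧ G.diam = 2 := by
  have he (u : V) : ⨆ w, G.edist u w = 2 := by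
    apply le_antisymm
    · refine iSup_le fun v ↦ ?_
      obtain ⟨w, huw, hwv⟩ := h u v
      exact (Walk.cons huw (Walk.cons hwv Walk.nil)).edist_le
    · by_contra! hlt
      obtain ⟨w, hw⟩ := hc u
      rw [G.compl_adj] at hw
      exact hw.2 ((G.eccent_le_one_iff u).1 (Order.le_of_lt_add_one (by
        rwa [one_add_one_eq_two])) w hw.1)
  have hd : G.ediam = 2 := by
    rw [ediam_eq_iSup_iSup_edist]
    simp [he]
  refine ⟨connected_of_ediam_ne_top (by simp [hd]), ?_, ?_⟩
  · simp [SimpleGraph.rad, he]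
  · simp [SimpleGraph.diam, hd]

/-- If a graph `G` of order `n ≥ 2` is not in `SCC(2)`, then `γ(G) ≤ 2` or `γ(Ḡ) ≤ 2`. -/
theorem domNum_le_two_or_compl_of_not_scc2 {V : Type*} [Fintype V] (G : SimpleGraph V)
    (hn : 2 ≤ Fintype.card V) (hG : ¬ G.IsSCC2) :
    G.domNum ≤ 2 ∨ Gᶜ.domNum ≤ 2 := by
  have : Nonempty V := Fintype.card_pos_iff.1 (by lia)
  by_contra! hlt
  have h₁ := SimpleGraph.exists_compl_adj_of_two_lt_domNum hlt.1
  have h₂ := SimpleGraph.exists_compl_adj_of_two_lt_domNum hlt.2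
  rw [compl_compl] at h₂
  obtain ⟨hG₁, hr₁, hd₁⟩ := SimpleGraph.connected_rad_diam_of_exists_adj h₂
    fun u ↦ (h₁ u u).imp fun _ ↦ And.left
  obtain ⟨hG₂, hr₂, hd₂⟩ := SimpleGraph.connected_rad_diam_of_exists_adj h₁
    fun u ↦ by simpa only [compl_compl] using (h₂ u u).imp fun _ ↦ And.left
  exact hG ⟨hG₁, hG₂, hr₁, hd₁, hr₂, hd₂⟩
end

section
/- Let G be a connected finite simple graph of order n ≥ 4 with γ(G) = ⌊√n⌋ =: k, and let {v_1, …, v_k} be a minimum dominating set of G. For 1 ≤ i ≤ k let V_i = epn[v_i, {v_1,…,v_k}] be the set of external private neighbors of v_i, and let V_{k+1} be the set of vertices outside {v_1,…,v_k} having at least two neighbors in {v_1,…,v_k}. Then V_1, …, V_k, V_{k+1} form a partition of V \ {v_1,…,v_k} and the data (v_1,…,v_k; V_1,…,V_k,V_{k+1}) is an 𝓕-structure with parameter k; that is: (a) k(k−1) ≤ n − k ≤ k² + k; (b) for every i, if v_i has a neighbor among {v_1,…,v_k} then V_i ≠ ∅; (c) for all i ≠ j in {1,…,k}, v_i is adjacent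 to every vertex of V_i and to no vertex of V_j; (d) every vertex of V_{k+1} is adjacent to at least two vertices of {v_1,…,v_k}; (e) (condition C) for every subset I ⊆ {1,…,k} with |I| = s and every set S of vertices of H₂^I that dominates H₂^I with |S| ≤ s − 1, one has |N_{H₁}(S) ∪ N_{H₁^I}(Ī)| ≤ s − 1. -/
/-- `S` is a set of vertices of the subgraph of `G` induced on `A` which dominates that
subgraph: `S ⊆ A` and every vertex of `A` outside `S` is `G`-adjacent to a vertex of `S`
(adjacency in the induced subgraph agrees with adjacency in `G`). -/
def SimpleGraph.DominatesOn {V : Type*} (G : SimpleGraph V) (A S : Set V) : Prop :=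
  S ⊆ A ∧ ∀ w ∈ A, w ∉ S → ∃ u ∈ S, G.Adj u w

/-- The vertex set of the induced subgraph `H₂^I`: the union of the `Vᵢ` for `i ∈ I`
together with the vertices of `V_{k+1}` having no neighbor `v_j` with `j ∉ I`. -/
def H2I {V : Type*} {k : ℕ} (G : SimpleGraph V) (v : Fin k → V)
    (Vi : Fin k → Set V) (Vlast : Set V) (I : Set (Fin k)) : Set V :=
  (⋃ i ∈ I, Vi i) ∪ {w ∈ Vlast | ∀ j ∉ I, ¬ G.Adj w (v j)}

/-- `N_{H₁}(S)`: the set of vertices `vᵢ` (`1 ≤ i ≤ k`) adjacent in `G` to a vertex of `S`. -/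
def NH1 {V : Type*} {k : ℕ} (G : SimpleGraph V) (v : Fin k → V) (S : Set V) : Set V :=
  {x | ∃ i : Fin k, x = v i ∧ ∃ u ∈ S, G.Adj (v i) u}

/-- `N_{H₁^I}(Ī)`: the set of vertices `vᵢ` with `i ∈ I` adjacent in `G` to some `v_j`
with `j ∉ I`. -/
def NH1I {V : Type*} {k : ℕ} (G : SimpleGraph V) (v : Fin k → V) (I : Set (Fin k)) : Set V :=
  {x | ∃ i ∈ I, x = v i ∧ ∃ j ∉ I, G.Adj (v i) (v j)}

/-- An `𝓕`-structure with parameter `k` on `G`: distinct vertices `v 0, …, v (k-1)` and a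
partition `V 0, …, V (k-1), Vlast` of the remaining vertices satisfying conditions
(a)–(d) and condition (C) of the family `𝓕`. -/
structure IsFStructure {V : Type*} [Fintype V] (G : SimpleGraph V) (k : ℕ)
    (v : Fin k → V) (Vi : Fin k → Set V) (Vlast : Set V) : Prop where
  /-- the `vᵢ` are distinct -/
  inj : Function.Injective v
  /-- the blocks `Vᵢ` are pairwise disjoint -/
  disj : ∀ i j : Fin k, i ≠ j → Disjoint (Vi i) (Vi j)
  /-- each `Vᵢ` is disjoint from `V_{k+1}` -/
  disj_last : ∀ i : Fin k, Disjoint (Vi i) Vlast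
  /-- the blocks cover exactly the vertices outside `{v 0, …, v (k-1)}` -/
  cover : ((⋃ i : Fin k, Vi i) ∪ Vlast) = Set.univ \ Set.range v
  /-- (a) lower bound: `k(k-1) ≤ n - k` -/
  card_lb : k * (k - 1) ≤ Fintype.card V - k
  /-- (a) upper bound: `n - k ≤ k² + k` -/
  card_ub : Fintype.card V - k ≤ k ^ 2 + k
  /-- (b) if `vᵢ` has a neighbor among the `v_j`, then `Vᵢ ≠ ∅` -/
  nonempty_block : ∀ i : Fin k, (∃ j : Fin k, G.Adj (v i) (v j)) → (Vi i).Nonempty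
  /-- (c) `vᵢ` is adjacent to every vertex of `Vᵢ` -/
  adj_own : ∀ i : Fin k, ∀ w ∈ Vi i, G.Adj (v i) w
  /-- (c) `vᵢ` is adjacent to no vertex of `V_j` for `j ≠ i` -/
  not_adj_other : ∀ i j : Fin k, i ≠ j → ∀ w ∈ Vi j, ¬ G.Adj (v i) w
  /-- (d) every vertex of `V_{k+1}` is adjacent to at least two of the `vᵢ` -/
  last_two : ∀ w ∈ Vlast, ∃ i j : Fin k, i ≠ j ∧ G.Adj w (v i) ∧ G.Adj w (v j)
  /-- (e) condition (C): for every `I ⊆ {1,…,k}` with `|I| = s` and every dominating set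
  `S` of `H₂^I` with `|S| ≤ s - 1`, one has `|N_{H₁}(S) ∪ N_{H₁^I}(Ī)| ≤ s - 1` -/
  condC : ∀ (I : Set (Fin k)) (S : Set V), G.DominatesOn (H2I G v Vi Vlast I) S →
    S.ncard < I.ncard → (NH1 G v S ∪ NH1I G v I).ncard < I.ncard

theorem SimpleGraph.IsDomSet.domNum_le_s9 {V : Type*} [Fintype V] {G : SimpleGraph V} {D : Set V}
    (hD : G.IsDomSet D) : G.domNum ≤ D.ncard :=
  Nat.sInf_le ⟨D, hD, rfl⟩

/-- A vertex outside `D` has `d` as its only closed neighbor in `D` iff `d` is its only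
neighbor in `D`. -/
theorem SimpleGraph.closedNeighbors_eq_singleton_iff {V : Type*} {G : SimpleGraph V} {D : Set V}
    {d w : V} (hd : d ∈ D) (hw : w ∉ D) :
    {u ∈ D | u = w ∨ G.Adj u w} = {d} ↔ G.Adj d w ∧ ∀ u ∈ D, G.Adj u w → u = d := by
  constructor
  · intro h
    have hmem : d ∈ {u ∈ D | u = w ∨ G.Adj u w} := h ▸ Set.mem_singleton d
    refine ⟨hmem.2.resolve_left fun e => hw (e ▸ hd), fun u hu huw => ?_⟩
    have : u ∈ {u ∈ D | u = w ∨ G.Adj u w} := ⟨hu, Or.inr huw⟩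
    rwa [h] at this
  · rintro ⟨hdw, huniq⟩
    ext u
    constructor
    · rintro ⟨hu, rfl | huw⟩
      · exact absurd hu hw
      · exact huniq u hu huw
    · rintro rfl
      exact ⟨hd, Or.inr hdw⟩

theorem two_le_ncard_neighbors_range_iff {V : Type*} {k : ℕ} (G : SimpleGraph V)
    {v : Fin k → V} (hinj : Function.Injective v) (w : V) :
    2 ≤ {u ∈ Set.range v | G.Adj u w}.ncard ↔
      ∃ i j : Fin k, i ≠ j ∧ G.Adj w (v i) ∧ G.Adj w (v j) := by
  have hfin : {u ∈ Set.range v | G.Adj u w}.Finite := (Set.finite_range v).subset fun _ h => h.1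
  rw [← Nat.lt_iff_add_one_le, Set.one_lt_ncard hfin]
  constructor
  · rintro ⟨_, ⟨⟨i, rfl⟩, hi⟩, _, ⟨⟨j, rfl⟩, hj⟩, hne⟩
    exact ⟨i, j, fun h => hne (h ▸ rfl), hi.symm, hj.symm⟩
  · rintro ⟨i, j, hne, hi, hj⟩
    exact ⟨v i, ⟨⟨i, rfl⟩, hi.symm⟩, v j, ⟨⟨j, rfl⟩, hj.symm⟩, hinj.ne hne⟩

/-- The vertices `v j` with `j ∉ I`, together with a set dominating `H₂^I`, form a dominating
set as soon as every `v i` with `i ∈ I` has a neighbor among them. -/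
theorem SimpleGraph.isDomSet_union_image_compl {V : Type*} {k : ℕ} {G : SimpleGraph V}
    {v : Fin k → V} {Vi : Fin k → Set V} {Vlast : Set V}
    (hcover : ((⋃ i : Fin k, Vi i) ∪ Vlast) = Set.univ \ Set.range v)
    (hown : ∀ i, ∀ w ∈ Vi i, G.Adj (v i) w) {I : Set (Fin k)} {S : Set V}
    (hS : G.DominatesOn (H2I G v Vi Vlast I) S)
    (hI : v '' I ⊆ NH1 G v S ∪ NH1I G v I) : G.IsDomSet (S ∪ v '' Iᶜ) := by
  intro w hw
  simp only [Set.mem_union, not_or] at hw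
  have himage (j : Fin k) (hj : j ∉ I) : v j ∈ S ∪ v '' Iᶜ := Or.inr ⟨j, hj, rfl⟩
  have hH2 (h : w ∈ H2I G v Vi Vlast I) : ∃ u ∈ S ∪ v '' Iᶜ, G.Adj u w := by
    obtain ⟨u, hu, huw⟩ := hS.2 w h hw.1
    exact ⟨u, Or.inl hu, huw⟩
  by_cases hwD : w ∈ Set.range v
  · obtain ⟨i, rfl⟩ := hwD
    have hi : i ∈ I := by
      by_contra hi
      exact hw.2 ⟨i, hi, rfl⟩
    obtain ⟨l, hl, u, hu, hadj⟩ | ⟨l, -, hl, j, hj, hadj⟩ := hI ⟨i, hi, rfl⟩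
    · exact ⟨u, Or.inl hu, hl ▸ hadj.symm⟩
    · exact ⟨v j, himage j hj, hl ▸ hadj.symm⟩
  · have hmem : w ∈ (⋃ i : Fin k, Vi i) ∪ Vlast := hcover ▸ ⟨trivial, hwD⟩
    obtain hmem | hmem := hmem
    · obtain ⟨i, hi⟩ := Set.mem_iUnion.1 hmem
      by_cases hiI : i ∈ I
      · exact hH2 (Or.inl (Set.mem_biUnion hiI hi))
      · exact ⟨v i, himage i hiI, hown i w hi⟩
    · by_cases h : ∀ j ∉ I, ¬ G.Adj w (v j)
      · exact hH2 (Or.inr ⟨hmem, h⟩)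
      · push Not at h
        obtain ⟨j, hj, hadj⟩ := h
        exact ⟨v j, himage j hj, hadj.symm⟩

/-- The neighbors `v i` of a set of vertices of `H₂^I` all have `i ∈ I`. -/
theorem NH1_union_NH1I_subset {V : Type*} {k : ℕ} {G : SimpleGraph V}
    {v : Fin k → V} {Vi : Fin k → Set V} {Vlast : Set V}
    (hother : ∀ i j : Fin k, i ≠ j → ∀ w ∈ Vi j, ¬ G.Adj (v i) w) {I : Set (Fin k)} {S : Set V}
    (hS : S ⊆ H2I G v Vi Vlast I) : NH1 G v S ∪ NH1I G v I ⊆ v '' I := by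
  rintro _ (⟨i, rfl, u, hu, hadj⟩ | ⟨i, hi, rfl, -⟩)
  · refine ⟨i, ?_, rfl⟩
    by_contra hi
    obtain hu | hu := hS hu
    · obtain ⟨j, hj, huj⟩ := Set.mem_iUnion₂.1 hu
      exact hother i j (fun h => hi (h ▸ hj)) u huj hadj
    · exact hu.2 i hi hadj.symm
  · exact ⟨i, hi, rfl⟩

/-- Let `G` be a connected graph of order `n ≥ 4` with `γ(G) = ⌊√n⌋ = k`, let
`{v 0, …, v (k-1)}` be a minimum dominating set of `G`, let `Vᵢ` be the set of external
private neighbors of `vᵢ`, and let `Vlast` be the set of remaining vertices having at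
least two neighbors among the `vᵢ`.  Then these data form an `𝓕`-structure with
parameter `k` on `G` (in particular, the `Vᵢ` together with `Vlast` partition the
vertices outside `{v 0, …, v (k-1)}`). -/
theorem isFStructure_of_domNum_eq_sqrt {V : Type*} [Fintype V] (G : SimpleGraph V)
    (hn : 4 ≤ Fintype.card V) (hconn : G.Connected)
    (k : ℕ) (hk : k = ⌊Real.sqrt (Fintype.card V)⌋₊) (hγ : G.domNum = k)
    (v : Fin k → V) (hinj : Function.Injective v) (hdom : G.IsDomSet (Set.range v))
    (Vi : Fin k → Set V) (Vlast : Set V)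
    (hVi : ∀ i : Fin k,
      Vi i = {w | w ∉ Set.range v ∧ {u ∈ Set.range v | u = w ∨ G.Adj u w} = {v i}})
    (hVlast : Vlast = {w | w ∉ Set.range v ∧ 2 ≤ {u ∈ Set.range v | G.Adj u w}.ncard}) :
    IsFStructure G k v Vi Vlast := by
  have hmemVi (i : Fin k) (w : V) :
      w ∈ Vi i ↔ w ∉ Set.range v ∧ G.Adj (v i) w ∧ ∀ j, G.Adj (v j) w → j = i := by
    rw [hVi i]
    refine and_congr_right fun hw => ?_
    rw [SimpleGraph.closedNeighbors_eq_singleton_iff (Set.mem_range_self i) hw]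
    simp [hinj.eq_iff]
  have hmemVlast (w : V) :
      w ∈ Vlast ↔ w ∉ Set.range v ∧ ∃ i j : Fin k, i ≠ j ∧ G.Adj w (v i) ∧ G.Adj w (v j) := by
    rw [hVlast, ← two_le_ncard_neighbors_range_iff G hinj w]
    rfl
  have hcover : ((⋃ i : Fin k, Vi i) ∪ Vlast) = Set.univ \ Set.range v := by
    ext w
    simp only [Set.mem_union, Set.mem_iUnion, hmemVi, hmemVlast, Set.mem_sdiff, Set.mem_univ,
      true_and]
    constructor
    · rintro (⟨i, h⟩ | h) <;> exact h.1
    · intro hw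
      obtain ⟨_, ⟨i, rfl⟩, hi⟩ := hdom w hw
      by_cases huniq : ∀ j, G.Adj (v j) w → j = i
      · exact Or.inl ⟨i, hw, hi, huniq⟩
      · push Not at huniq
        obtain ⟨j, hj, hne⟩ := huniq
        exact Or.inr ⟨hw, j, i, hne, hj.symm, hi.symm⟩
  have hown : ∀ i, ∀ w ∈ Vi i, G.Adj (v i) w := fun i w hw => ((hmemVi i w).1 hw).2.1
  have hother : ∀ i j : Fin k, i ≠ j → ∀ w ∈ Vi j, ¬ G.Adj (v i) w :=
    fun i j hne w hw hadj => hne (((hmemVi j w).1 hw).2.2 i hadj)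
  have hsqrt : k = Nat.sqrt (Fintype.card V) := by rw [hk, Real.nat_floor_real_sqrt_eq_nat_sqrt]
  have hlb : k * k ≤ Fintype.card V := hsqrt ▸ Nat.sqrt_le _
  have hub : Fintype.card V ≤ k * k + k + k := hsqrt ▸ Nat.sqrt_le_add _
  refine
    { inj := hinj
      disj := fun i j hne => Set.disjoint_left.2 fun w hi hj => hother i j hne w hj (hown i w hi)
      disj_last := fun i => Set.disjoint_left.2 fun w hi hl => ?_
      cover := hcover
      card_lb := ?_
      card_ub := ?_
      nonempty_block := ?_
      adj_own := hown
      not_adj_other := hother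
      last_two := fun w hw => ((hmemVlast w).1 hw).2
      condC := ?_ }
  · obtain ⟨-, a, b, hab, ha, hb⟩ := (hmemVlast w).1 hl
    have huniq := ((hmemVi i w).1 hi).2.2
    exact hab ((huniq a ha.symm).trans (huniq b hb.symm).symm)
  · rw [Nat.mul_sub_one]
    exact Nat.sub_le_sub_right hlb k
  · rw [pow_two]
    omega
  · rintro i ⟨j, hij⟩
    by_contra hempty
    have hD : G.IsDomSet (v '' {i}ᶜ) := by
      intro w hw
      by_cases hwD : w ∈ Set.range v
      · obtain ⟨l, rfl⟩ := hwD
        have hl : l = i := by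
          by_contra hl
          exact hw ⟨l, hl, rfl⟩
        subst hl
        exact ⟨v j, ⟨j, fun h => G.ne_of_adj hij (congrArg v h).symm, rfl⟩, hij.symm⟩
      · obtain ⟨_, ⟨l, rfl⟩, hl⟩ := hdom w hwD
        by_contra hno
        have huniq (m : Fin k) (hm : G.Adj (v m) w) : m = i := by
          by_contra hmi
          exact hno ⟨v m, ⟨m, hmi, rfl⟩, hm⟩
        exact hempty ⟨w, (hmemVi i w).2 ⟨hwD, huniq l hl ▸ hl, huniq⟩⟩
    have hle := hD.domNum_le_s9
    have hcard := Set.ncard_add_ncard_compl ({i} : Set (Fin k))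
    rw [hγ, Set.ncard_image_of_injective _ hinj] at hle
    rw [Set.ncard_singleton, Nat.card_fin] at hcard
    omega
  · intro I S hS hlt
    by_contra hge
    have hI : v '' I ⊆ NH1 G v S ∪ NH1I G v I := by
      refine (Set.eq_of_subset_of_ncard_le (NH1_union_NH1I_subset hother hS.1) ?_).ge
      rw [Set.ncard_image_of_injective _ hinj]
      exact not_lt.1 hge
    have hle := (SimpleGraph.isDomSet_union_image_compl hcover hown hS hI).domNum_le_s9
    have hunion := Set.ncard_union_le S (v '' Iᶜ)
    have hcard := Set.ncard_add_ncard_compl I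
    rw [Set.ncard_image_of_injective _ hinj] at hunion
    rw [Nat.card_fin] at hcard
    omega
end

section
/- Let G be a finite simple graph on vertex set V, let k ≥ 2, and suppose distinct vertices v_1, …, v_k and a partition V_1, …, V_k, V_{k+1} of V \ {v_1,…,v_k} satisfy: for every i, if v_i has a neighbor among {v_1,…,v_k} then V_i ≠ ∅; for all i ≠ j, v_i is adjacent to every vertex of V_i and to no vertex of V_j; and every vertex of V_{k+1} is adjacent to at least two vertices of {v_1,…,v_k}. Then no proper subset D ⊊ {v_1, …, v_k} is a dominating set of G. -/
/-- Suppose distinct vertices `v 0, …, v (k-1)` (`k ≥ 2`) and a partition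
`V 0, …, V (k-1), Vlast` of the remaining vertices satisfy: whenever `vᵢ` has a neighbor
among the `v_j` then `Vᵢ ≠ ∅`; `vᵢ` is adjacent to every vertex of `Vᵢ` and to no vertex
of `V_j` for `j ≠ i`; and every vertex of `Vlast` is adjacent to at least two of the `vᵢ`.
Then no proper subset of `{v 0, …, v (k-1)}` is a dominating set of `G`. -/
theorem no_proper_subset_dominates {V : Type*} [Fintype V] (G : SimpleGraph V) (k : ℕ)
    (hk : 2 ≤ k) (v : Fin k → V) (Vi : Fin k → Set V) (Vlast : Set V)
    (hinj : Function.Injective v)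
    (hdisj : ∀ i j : Fin k, i ≠ j → Disjoint (Vi i) (Vi j))
    (hdisj_last : ∀ i : Fin k, Disjoint (Vi i) Vlast)
    (hcover : ((⋃ i : Fin k, Vi i) ∪ Vlast) = Set.univ \ Set.range v)
    (hnonempty : ∀ i : Fin k, (∃ j : Fin k, G.Adj (v i) (v j)) → (Vi i).Nonempty)
    (hadj_own : ∀ i : Fin k, ∀ w ∈ Vi i, G.Adj (v i) w)
    (hnot_adj : ∀ i j : Fin k, i ≠ j → ∀ w ∈ Vi j, ¬ G.Adj (v i) w)
    (hlast : ∀ w ∈ Vlast, ∃ i j : Fin k, i ≠ j ∧ G.Adj w (v i) ∧ G.Adj w (v j)) :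
    ∀ D : Set V, D ⊂ Set.range v → ¬ G.IsDomSet D := by
  intro D hD hdom
  obtain ⟨hsub, _, ⟨i, rfl⟩, hi⟩ := Set.ssubset_iff_exists.mp hD
  obtain ⟨u, hu, hadj⟩ := hdom (v i) hi
  obtain ⟨j, rfl⟩ := hsub hu
  obtain ⟨w, hw⟩ := hnonempty i ⟨j, hadj.symm⟩
  have hw_range : w ∈ Set.univ \ Set.range v :=
    hcover ▸ Or.inl (Set.mem_iUnion.mpr ⟨i, hw⟩)
  obtain ⟨x, hx, hxw⟩ := hdom w fun h => hw_range.2 (hsub h)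
  obtain ⟨l, rfl⟩ := hsub hx
  exact hnot_adj l i (fun h => hi (h ▸ hx)) w hw hxw
end
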